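/- Let δ > 0 and define (p_n) by p₀ = 1+δ, p_{n+1} = 1+δ − 1/(1+δ+p_n); set N := ⌊δ^{−1/2}⌋. There exist constants C > 0 and δ₀ ∈ (0,1) such that for all δ ∈ (0,δ₀) and all integers n > N one has √(2δ) ≤ p_n ≤ C·√δ. -/

import Mathlib

open Real

theorem stmt_8 :
    ∃ C > (0:ℝ), ∃ δ₀ ∈ Set.Ioo (0:ℝ) 1, ∀ δ ∈ Set.Ioo (0:ℝ) δ₀,
      ∀ p : ℕ → ℝ, p 0 = 1 + δ →
        (∀ n, p (n + 1) = 1 + δ - 1 / (1 + δ + p n)) →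
        ∀ n : ℕ, ⌊δ ^ (-(1:ℝ)/2)⌋₊ < n →
          Real.sqrt (2 * δ) ≤ p n ∧ p n ≤ C * Real.sqrt δ := by
  refine ⟨3, by norm_num, 1/2, by norm_num, ?_⟩
  rintro δ ⟨hδ, hδ1⟩ p h0 hp n hn
  obtain ⟨q, hq⟩ : ∃ q, q = Real.sqrt (2 * δ + δ ^ 2) := ⟨_, rfl⟩
  have hq0 : 0 ≤ q := hq ▸ Real.sqrt_nonneg _
  have hq2 : q ^ 2 = 2 * δ + δ ^ 2 := by rw [hq]; exact Real.sq_sqrt (by positivity)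
  have key : ∀ k : ℕ, 0 ≤ p k - q ∧ (k : ℝ) * (p k - q) ≤ 1 := by
    intro k
    induction k with
    | zero =>
      refine ⟨?_, by simp⟩
      rw [h0]
      nlinarith
    | succ k ih =>
      obtain ⟨h1, h2⟩ := ih
      have hA : 0 < 1 + δ + q := by positivity
      have hB : 0 < 1 + δ + p k := by linarith
      have e : p (k+1) - q = (p k - q) / ((1 + δ + q) * (1 + δ + p k)) := by
        rw [hp k]
        field_simp
        linear_combination (-(1 + δ + p k)) * hq2
      have hAB : 1 + (p k - q) ≤ (1 + δ + q) * (1 + δ + p k) := by nlinarith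
      rw [e]
      refine ⟨by positivity, ?_⟩
      rw [← mul_div_assoc, div_le_one (by positivity)]
      push_cast
      linarith
  obtain ⟨h1, h2⟩ := key n
  have hs : 0 < Real.sqrt δ := Real.sqrt_pos.2 hδ
  have hs2 : Real.sqrt δ ^ 2 = δ := Real.sq_sqrt hδ.le
  have hn' : δ ^ (-(1:ℝ)/2) < n := (Nat.floor_lt (by positivity)).1 hn
  have hr : δ ^ (-(1:ℝ)/2) = (Real.sqrt δ)⁻¹ := by
    rw [Real.sqrt_eq_rpow, ← Real.rpow_neg hδ.le]; norm_num
  rw [hr] at hn'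
  have hns : 1 < n * Real.sqrt δ := by
    rwa [inv_lt_iff_one_lt_mul₀ hs] at hn'
  have hnpos : (0:ℝ) < n := lt_trans (by positivity) hn'
  have he : p n - q ≤ Real.sqrt δ := by
    by_contra! hc
    nlinarith
  have hq3a : q ^ 2 ≤ (2 * Real.sqrt δ) ^ 2 := by nlinarith
  have hq3 : q ≤ 2 * Real.sqrt δ := by
    exact (pow_le_pow_iff_left₀ hq0 (by positivity) two_ne_zero).1 hq3a
  constructor
  · have : Real.sqrt (2 * δ) ≤ q := hq ▸ Real.sqrt_le_sqrt (by nlinarith)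
    linarith
  · linarith
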